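/- Let k, k', n, m, d be positive integers with k ≤ k' and 2n + k + k' = d − m, and set l = min(n, m). Then S_d(n, n+k, n+k') ⊆ co{ ((d−1)/d)·S_{d−1}(n, n+k, n+k'), ((d−l)/d)·S_{d−l}(n−l, n+k, n+k') }. -/

import Mathlib

open Matrix
open scoped Pointwise ComplexOrder

/-- `P` is an orthogonal projection matrix: `P = P† = P²`. -/
def IsProjn {d : ℕ} (P : Matrix (Fin d) (Fin d) ℂ) : Prop :=
  P.IsHermitian ∧ P * P = P

/-- `corrSet d n₁ n₂ n₃` is the set `S_d(n₁,n₂,n₃) ⊆ ℝ³` of triples of normalized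
traces of pairwise products of orthogonal projections of the prescribed ranks. -/
def corrSet (d n₁ n₂ n₃ : ℕ) : Set (ℝ × ℝ × ℝ) :=
  { x | ∃ P₁ P₂ P₃ : Matrix (Fin d) (Fin d) ℂ,
      IsProjn P₁ ∧ IsProjn P₂ ∧ IsProjn P₃ ∧
      P₁.rank = n₁ ∧ P₂.rank = n₂ ∧ P₃.rank = n₃ ∧
      x = ((1 / (d : ℝ)) * ((P₁ * P₂).trace).re,
           (1 / (d : ℝ)) * ((P₁ * P₃).trace).re,
           (1 / (d : ℝ)) * ((P₂ * P₃).trace).re) }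

theorem IsCompact.convexHull_of_finiteDimensional {E : Type*} [NormedAddCommGroup E]
    [NormedSpace ℝ E] [FiniteDimensional ℝ E] {s : Set E} (hs : IsCompact s) :
    IsCompact (convexHull ℝ s) := by
  obtain rfl | ⟨x₀, hx₀⟩ := s.eq_empty_or_nonempty
  · simp
  let N := Module.finrank ℝ E + 1
  let F : (Fin N → ℝ) × (Fin N → E) → E := fun p ↦ ∑ i, p.1 i • p.2 i
  have hF : Continuous F := by fun_prop
  have hK : IsCompact (stdSimplex ℝ (Fin N) ×ˢ Set.univ.pi fun _ : Fin N ↦ s) :=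
    (isCompact_stdSimplex ℝ (Fin N)).prod (isCompact_univ_pi fun _ ↦ hs)
  convert hK.image hF using 1
  refine Set.Subset.antisymm (fun x hx ↦ ?_) ?_
  · obtain ⟨ι, _, z, w, hz, hind, hw, hw1, rfl⟩ := eq_pos_convex_span_of_mem_convexHull hx
    have hcard : Fintype.card ι ≤ Fintype.card (Fin N) := by
      have := hind.card_le_finrank_succ
      have := Submodule.finrank_le (vectorSpan ℝ (Set.range z))
      simp only [Fintype.card_fin, N]
      lia
    obtain ⟨e⟩ := Function.Embedding.nonempty_of_card_le hcard
    refine ⟨(Function.extend e w 0, Function.extend e z fun _ ↦ x₀), ⟨⟨fun i ↦ ?_, ?_⟩, ?_⟩, ?_⟩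
    · by_cases hi : ∃ j, e j = i
      · obtain ⟨j, rfl⟩ := hi
        simpa [e.injective.extend_apply] using (hw j).le
      · simp [Function.extend_apply' _ _ _ hi]
    · rw [← hw1]
      refine (Fintype.sum_of_injective e e.injective _ _ (fun i hi ↦ ?_) fun i ↦ ?_).symm
      · exact Function.extend_apply' _ _ _ hi
      · exact (e.injective.extend_apply _ _ _).symm
    · intro i _
      by_cases hi : ∃ j, e j = i
      · obtain ⟨j, rfl⟩ := hi
        simpa [e.injective.extend_apply] using hz ⟨j, rfl⟩
      · simpa [Function.extend_apply' _ _ _ hi] using hx₀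
    · refine (Fintype.sum_of_injective e e.injective _ _ (fun i hi ↦ ?_) fun i ↦ ?_).symm
      · simp [Function.extend_apply' _ _ _ hi]
      · simp [e.injective.extend_apply]
  · rintro _ ⟨⟨w, z⟩, ⟨⟨hw, hw1⟩, hz⟩, rfl⟩
    exact (convex_convexHull ℝ s).sum_mem (fun i _ ↦ hw i) hw1
      fun i _ ↦ subset_convexHull ℝ s (hz i trivial)

theorem IsProjn.trace_eq_rank {d : ℕ} {P : Matrix (Fin d) (Fin d) ℂ} (hP : IsProjn P) :
    P.trace = P.rank := by
  have hidem : IsIdempotentElem (Matrix.toLin' P) := by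
    rw [IsIdempotentElem, Module.End.mul_eq_comp, ← Matrix.toLin'_mul, hP.2]
  have := (LinearMap.IsIdempotentElem.isProj_range _ hidem).trace
  rwa [Matrix.trace_toLin'_eq] at this

theorem IsProjn.rank_eq_iff {d r : ℕ} {P : Matrix (Fin d) (Fin d) ℂ} (hP : IsProjn P) :
    P.rank = r ↔ P.trace = r := by
  rw [hP.trace_eq_rank, Nat.cast_inj]

theorem IsProjn.norm_apply_le {d : ℕ} {P : Matrix (Fin d) (Fin d) ℂ} (hP : IsProjn P)
    (i j : Fin d) : ‖P i j‖ ≤ 1 := by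
  have hU : (2 : ℂ) • P - 1 ∈ Matrix.unitaryGroup (Fin d) ℂ := by
    rw [Matrix.mem_unitaryGroup_iff, Matrix.star_eq_conjTranspose, Matrix.conjTranspose_sub,
      Matrix.conjTranspose_smul, hP.1.eq]
    simp only [sub_mul, mul_sub, Matrix.smul_mul, Matrix.mul_smul, hP.2]
    simp
    module
  have h := entry_norm_bound_of_unitary hU i j
  have h1 : ‖(1 : Matrix (Fin d) (Fin d) ℂ) i j‖ ≤ 1 := by
    rw [Matrix.one_apply]; split_ifs <;> simp
  have h2 : (2 : ℂ) * P i j = ((2 : ℂ) • P - 1) i j + (1 : Matrix (Fin d) (Fin d) ℂ) i j := by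
    simp
  have h3 := norm_add_le (((2 : ℂ) • P - 1) i j) ((1 : Matrix (Fin d) (Fin d) ℂ) i j)
  rw [← h2, norm_mul, Complex.norm_ofNat] at h3
  linarith

theorem isCompact_setOf_isProjn_rank_eq (d r : ℕ) :
    IsCompact {P : Matrix (Fin d) (Fin d) ℂ | IsProjn P ∧ P.rank = r} := by
  have hK : IsCompact (Set.univ.pi fun _ : Fin d ↦ Set.univ.pi fun _ : Fin d ↦
      Metric.closedBall (0 : ℂ) 1) :=
    isCompact_univ_pi fun _ ↦ isCompact_univ_pi fun _ ↦ isCompact_closedBall 0 1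
  refine IsCompact.of_isClosed_subset (s := (Set.univ.pi fun _ : Fin d ↦ Set.univ.pi fun _ : Fin d ↦
      Metric.closedBall (0 : ℂ) 1 : Set (Matrix (Fin d) (Fin d) ℂ))) hK ?_ ?_
  · have : {P : Matrix (Fin d) (Fin d) ℂ | IsProjn P ∧ P.rank = r} =
        {P | Pᴴ = P} ∩ {P | P * P = P} ∩ {P | P.trace = (r : ℂ)} := by
      ext P
      exact ⟨fun h ↦ ⟨h.1, h.1.rank_eq_iff.1 h.2⟩,
        fun h ↦ ⟨h.1, (IsProjn.rank_eq_iff h.1).2 h.2⟩⟩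
    rw [this]
    refine ((isClosed_eq ?_ ?_).inter (isClosed_eq ?_ ?_)).inter (isClosed_eq ?_ ?_) <;> fun_prop
  · intro P hP i _ j _
    simpa using hP.1.norm_apply_le i j

theorem isCompact_corrSet (d n₁ n₂ n₃ : ℕ) : IsCompact (corrSet d n₁ n₂ n₃) := by
  let F : Matrix (Fin d) (Fin d) ℂ × Matrix (Fin d) (Fin d) ℂ × Matrix (Fin d) (Fin d) ℂ →
      ℝ × ℝ × ℝ := fun P ↦ ((1 / (d : ℝ)) * ((P.1 * P.2.1).trace).re,
        (1 / (d : ℝ)) * ((P.1 * P.2.2).trace).re, (1 / (d : ℝ)) * ((P.2.1 * P.2.2).trace).re)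
  have hF : Continuous F := by fun_prop
  convert ((isCompact_setOf_isProjn_rank_eq d n₁).prod
    ((isCompact_setOf_isProjn_rank_eq d n₂).prod (isCompact_setOf_isProjn_rank_eq d n₃))).image hF
    using 1
  ext x
  constructor
  · rintro ⟨P₁, P₂, P₃, h₁, h₂, h₃, r₁, r₂, r₃, rfl⟩
    exact ⟨(P₁, P₂, P₃), ⟨⟨h₁, r₁⟩, ⟨h₂, r₂⟩, h₃, r₃⟩, rfl⟩
  · rintro ⟨⟨P₁, P₂, P₃⟩, ⟨⟨h₁, r₁⟩, ⟨h₂, r₂⟩, h₃, r₃⟩, rfl⟩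
    exact ⟨P₁, P₂, P₃, h₁, h₂, h₃, r₁, r₂, r₃, rfl⟩

theorem IsProjn.conj_unitary {d : ℕ} {P U : Matrix (Fin d) (Fin d) ℂ} (hP : IsProjn P)
    (hU : Uᴴ * U = 1) : IsProjn (U * P * Uᴴ) ∧ (U * P * Uᴴ).rank = P.rank := by
  have h : IsProjn (U * P * Uᴴ) := by
    refine ⟨Matrix.isHermitian_mul_mul_conjTranspose U hP.1, ?_⟩
    calc U * P * Uᴴ * (U * P * Uᴴ) = U * P * (Uᴴ * U) * P * Uᴴ := by simp only [Matrix.mul_assoc]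
      _ = U * P * Uᴴ := by rw [hU, Matrix.mul_one, Matrix.mul_assoc U P P, hP.2]
  refine ⟨h, h.rank_eq_iff.2 ?_⟩
  rw [Matrix.trace_mul_comm, ← Matrix.mul_assoc, hU, Matrix.one_mul, hP.trace_eq_rank]

section Exponential

attribute [local instance] Matrix.linftyOpNormedRing Matrix.linftyOpNormedAlgebra

theorem mul_comm_of_forall_unitary_trace_le {d : ℕ} {P A : Matrix (Fin d) (Fin d) ℂ}
    (hP : P.IsHermitian) (hA : A.IsHermitian)
    (hmax : ∀ U : Matrix (Fin d) (Fin d) ℂ, Uᴴ * U = 1 →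
      (U * P * Uᴴ * A).trace.re ≤ (P * A).trace.re) : P * A = A * P := by
  set X := A * P - P * A with hX
  have hXs : Xᴴ = -X := by
    simp [hX, Matrix.conjTranspose_sub, Matrix.conjTranspose_mul, hP.eq, hA.eq]
  have hstar (t : ℝ) : (NormedSpace.exp (t • X))ᴴ = NormedSpace.exp (t • (-X)) := by
    rw [← Matrix.exp_conjTranspose, Matrix.conjTranspose_smul, hXs, star_trivial]
  have huni (t : ℝ) : (NormedSpace.exp (t • X))ᴴ * NormedSpace.exp (t • X) = 1 := by
    rw [hstar, ← Matrix.exp_add_of_commute _ _ (by simp [smul_neg]), smul_neg, neg_add_cancel,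
      NormedSpace.exp_zero]
  have h1 := hasDerivAt_exp_smul_const (𝕂 := ℝ) X 0
  have h2 := hasDerivAt_exp_smul_const (𝕂 := ℝ) (-X) 0
  have h3 := ((h1.mul_const P).mul h2).mul_const A
  let T : Matrix (Fin d) (Fin d) ℂ →L[ℝ] ℝ :=
    LinearMap.toContinuousLinearMap (Complex.reLm ∘ₗ Matrix.traceLinearMap (Fin d) ℝ ℂ)
  have h4 := T.hasFDerivAt.comp_hasDerivAt (0 : ℝ) h3
  have hloc : IsLocalMax (T ∘ fun t : ℝ ↦ NormedSpace.exp (t • X) * P *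
      NormedSpace.exp (t • (-X)) * A) 0 := by
    refine Filter.Eventually.of_forall fun t ↦ ?_
    simpa [hstar, T] using hmax _ (huni t)
  have h5 := hloc.hasDerivAt_eq_zero h4
  have h6 : (X * Xᴴ).trace.re = 0 := by
    rw [hXs]
    have : (X * P * A - P * X * A).trace = (X * -X).trace := by
      rw [Matrix.trace_sub, Matrix.mul_assoc P, Matrix.trace_mul_comm P, Matrix.mul_assoc X,
        Matrix.mul_assoc X A, ← Matrix.trace_sub, ← mul_sub, hX, neg_sub]
    rw [← this]
    have h : ((X * P + -(P * X)) * A).trace.re = 0 := by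
      simp only [zero_smul, NormedSpace.exp_zero, one_mul, mul_one, mul_neg] at h5
      exact h5
    rwa [← sub_eq_add_neg, Matrix.sub_mul] at h
  have h7 : (X * Xᴴ).trace = 0 := by
    have := (Matrix.posSemidef_self_mul_conjTranspose X).trace_nonneg
    exact Complex.ext h6 (Complex.nonneg_iff.1 this).2.symm
  have h8 : X = 0 := Matrix.trace_mul_conjTranspose_self_eq_zero_iff.1 h7
  exact (sub_eq_zero.1 h8).symm

end Exponential

theorem exists_isometry_of_finrank_eq {d l : ℕ}
    {W : Submodule ℂ (EuclideanSpace ℂ (Fin d))} (hW : Module.finrank ℂ W = l) :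
    ∃ V : Matrix (Fin d) (Fin (d - l)) ℂ, Vᴴ * V = 1 ∧
      ∀ x, WithLp.toLp 2 ((1 - V * Vᴴ) *ᵥ x) ∈ W := by
  have hdim : Module.finrank ℂ Wᗮ = d - l := by
    have := W.finrank_add_finrank_orthogonal
    rw [finrank_euclideanSpace_fin] at this
    omega
  let b := (stdOrthonormalBasis ℂ Wᗮ).reindex (finCongr hdim)
  let V : Matrix (Fin d) (Fin (d - l)) ℂ := Matrix.of fun i j ↦ (b j : EuclideanSpace ℂ (Fin d)) i
  have hV : Vᴴ * V = 1 := by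
    ext i j
    have := orthonormal_iff_ite.1 b.orthonormal i j
    rw [Submodule.coe_inner, PiLp.inner_apply] at this
    simp only [Matrix.mul_apply, Matrix.one_apply, ← this]
    simp [V, mul_comm]
  refine ⟨V, hV, fun x ↦ ?_⟩
  rw [← W.orthogonal_orthogonal]
  have hker : Vᴴ *ᵥ ((1 - V * Vᴴ) *ᵥ x) = 0 := by
    rw [Matrix.mulVec_mulVec, Matrix.mul_sub, ← Matrix.mul_assoc, hV]
    simp
  set y := (1 - V * Vᴴ) *ᵥ x
  rw [Submodule.mem_orthogonal]
  intro u hu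
  have hu' := b.sum_repr ⟨u, hu⟩
  have hu'' := congrArg Subtype.val hu'
  simp only [Submodule.coe_sum, Submodule.coe_smul] at hu''
  rw [← hu'', sum_inner]
  refine Finset.sum_eq_zero fun j _ ↦ ?_
  rw [inner_smul_left, PiLp.inner_apply]
  have := congrFun hker j
  simp only [Matrix.mulVec, dotProduct, Pi.zero_apply] at this
  rw [mul_eq_zero]
  right
  rw [← this]
  simp [V, mul_comm]

section Compression

variable {d e : ℕ} {P P' : Matrix (Fin d) (Fin d) ℂ} {V : Matrix (Fin d) (Fin e) ℂ} {ε : ℂ}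

theorem conjTranspose_mul_mul_one_sub_eq_zero (hV : Vᴴ * V = 1)
    (hP : P * (1 - V * Vᴴ) = ε • (1 - V * Vᴴ)) : Vᴴ * P * (1 - V * Vᴴ) = 0 := by
  rw [Matrix.mul_assoc, hP, Matrix.mul_smul, Matrix.mul_sub, ← Matrix.mul_assoc, hV]
  simp

theorem compress_mul_compress (hV : Vᴴ * V = 1) (hP : P * (1 - V * Vᴴ) = ε • (1 - V * Vᴴ)) :
    Vᴴ * P * V * (Vᴴ * P' * V) = Vᴴ * (P * P') * V := by
  have h := conjTranspose_mul_mul_one_sub_eq_zero hV hP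
  rw [Matrix.mul_sub, Matrix.mul_one, sub_eq_zero] at h
  calc Vᴴ * P * V * (Vᴴ * P' * V) = Vᴴ * P * (V * Vᴴ) * P' * V := by simp only [Matrix.mul_assoc]
    _ = Vᴴ * (P * P') * V := by rw [← h, Matrix.mul_assoc Vᴴ P P']

theorem IsProjn.compress (hP : IsProjn P) (hV : Vᴴ * V = 1)
    (hPV : P * (1 - V * Vᴴ) = ε • (1 - V * Vᴴ)) : IsProjn (Vᴴ * P * V) :=
  ⟨Matrix.isHermitian_conjTranspose_mul_mul V hP.1, by rw [compress_mul_compress hV hPV, hP.2]⟩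

theorem trace_compress (hV : Vᴴ * V = 1) (hPV : P * (1 - V * Vᴴ) = ε • (1 - V * Vᴴ)) :
    (Vᴴ * P * V).trace = P.trace - ε * ((d : ℂ) - e) := by
  have h := congrArg Matrix.trace hPV
  rw [Matrix.mul_sub, Matrix.mul_one, Matrix.trace_smul, Matrix.trace_sub, Matrix.trace_sub,
    Matrix.trace_mul_comm V, hV, Matrix.trace_one, Matrix.trace_one, Fintype.card_fin,
    Fintype.card_fin, smul_eq_mul] at h
  rw [Matrix.mul_assoc, Matrix.trace_mul_comm, Matrix.mul_assoc, ← h, sub_sub_cancel]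

theorem trace_compress_mul_compress (hV : Vᴴ * V = 1)
    (hPV : P * (1 - V * Vᴴ) = ε • (1 - V * Vᴴ)) (hPV' : P' * (1 - V * Vᴴ) = 0) :
    (Vᴴ * P * V * (Vᴴ * P' * V)).trace = (P * P').trace := by
  have h : P * P' * (1 - V * Vᴴ) = (0 : ℂ) • (1 - V * Vᴴ) := by
    rw [Matrix.mul_assoc, hPV', Matrix.mul_zero, zero_smul]
  rw [compress_mul_compress hV hPV, trace_compress hV h, zero_mul, sub_zero]

end Compression

theorem mem_smul_corrSet_of_subspace {d l r₁ : ℕ} {P₁ P₂ P₃ : Matrix (Fin d) (Fin d) ℂ}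
    (h₁ : IsProjn P₁) (h₂ : IsProjn P₂) (h₃ : IsProjn P₃)
    {W : Submodule ℂ (EuclideanSpace ℂ (Fin d))} (hW : Module.finrank ℂ W = l) (hl : l < d)
    {ε : ℂ} (hε : (r₁ : ℂ) = P₁.rank - ε * l)
    (hW₁ : ∀ w ∈ W, P₁ *ᵥ w.ofLp = ε • w.ofLp) (hW₂ : ∀ w ∈ W, P₂ *ᵥ w.ofLp = 0)
    (hW₃ : ∀ w ∈ W, P₃ *ᵥ w.ofLp = 0) :
    ((1 / (d : ℝ)) * ((P₁ * P₂).trace).re, (1 / (d : ℝ)) * ((P₁ * P₃).trace).re,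
        (1 / (d : ℝ)) * ((P₂ * P₃).trace).re) ∈
      (((d : ℝ) - (l : ℕ)) / (d : ℝ)) • corrSet (d - l) r₁ P₂.rank P₃.rank := by
  obtain ⟨V, hV, hVW⟩ := exists_isometry_of_finrank_eq hW
  have key (P : Matrix (Fin d) (Fin d) ℂ) (δ : ℂ) (h : ∀ w ∈ W, P *ᵥ w.ofLp = δ • w.ofLp) :
      P * (1 - V * Vᴴ) = δ • (1 - V * Vᴴ) := by
    refine Matrix.ext_of_mulVec_single fun i ↦ ?_
    rw [← Matrix.mulVec_mulVec, Matrix.smul_mulVec]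
    exact h _ (hVW _)
  have hV₁ := key P₁ ε hW₁
  have hV₂ := key P₂ 0 (by simpa using hW₂)
  have hV₃ := key P₃ 0 (by simpa using hW₃)
  have hV₂' : P₂ * (1 - V * Vᴴ) = 0 := by simpa using hV₂
  have hV₃' : P₃ * (1 - V * Vᴴ) = 0 := by simpa using hV₃
  refine ⟨_, ⟨Vᴴ * P₁ * V, Vᴴ * P₂ * V, Vᴴ * P₃ * V, h₁.compress hV hV₁, h₂.compress hV hV₂,
    h₃.compress hV hV₃, ?_, ?_, ?_, rfl⟩, ?_⟩
  · rw [(h₁.compress hV hV₁).rank_eq_iff, trace_compress hV hV₁, h₁.trace_eq_rank, hε,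
      Nat.cast_sub hl.le, sub_sub_cancel]
  · rw [(h₂.compress hV hV₂).rank_eq_iff, trace_compress hV hV₂, h₂.trace_eq_rank, zero_mul,
      sub_zero]
  · rw [(h₃.compress hV hV₃).rank_eq_iff, trace_compress hV hV₃, h₃.trace_eq_rank, zero_mul,
      sub_zero]
  · have hd : (d : ℝ) ≠ 0 := by exact_mod_cast (by omega : d ≠ 0)
    have hdl : (d : ℝ) - l ≠ 0 := sub_ne_zero.2 (by exact_mod_cast hl.ne')
    have hscale (t : ℝ) : ((d : ℝ) - l) / d * (1 / ((d - l : ℕ) : ℝ) * t) = 1 / d * t := by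
      rw [Nat.cast_sub hl.le]
      field_simp
    simp only [trace_compress_mul_compress hV hV₁ hV₂', trace_compress_mul_compress hV hV₁ hV₃',
      trace_compress_mul_compress hV hV₂ hV₃', Prod.smul_mk, smul_eq_mul, hscale]

theorem le_finrank_ker_inf_ker {d : ℕ} (A B : Matrix (Fin d) (Fin d) ℂ) :
    d - (A.rank + B.rank) ≤ Module.finrank ℂ
      (LinearMap.ker A.toEuclideanLin ⊓ LinearMap.ker B.toEuclideanLin :
        Submodule ℂ (EuclideanSpace ℂ (Fin d))) := by
  have hA := A.toEuclideanLin.finrank_range_add_finrank_ker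
  have hB := B.toEuclideanLin.finrank_range_add_finrank_ker
  have hrank (M : Matrix (Fin d) (Fin d) ℂ) :
      Module.finrank ℂ (LinearMap.range M.toEuclideanLin) = M.rank :=
    (M.rank_eq_finrank_range_toLin (PiLp.basisFun 2 ℂ _) (PiLp.basisFun 2 ℂ _)).symm
  rw [hrank, finrank_euclideanSpace_fin] at hA hB
  have hsup := Submodule.finrank_sup_add_finrank_inf_eq (LinearMap.ker A.toEuclideanLin)
    (LinearMap.ker B.toEuclideanLin)
  have hle := Submodule.finrank_le
    (LinearMap.ker A.toEuclideanLin ⊔ LinearMap.ker B.toEuclideanLin)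
  rw [finrank_euclideanSpace_fin] at hle
  omega

theorem exists_submodule_le_finrank_eq {E : Type*} [AddCommGroup E] [Module ℂ E]
    (W : Submodule ℂ E) [FiniteDimensional ℂ W] {l : ℕ} (hl : l ≤ Module.finrank ℂ W) :
    ∃ W' ≤ W, Module.finrank ℂ W' = l := by
  obtain ⟨f, hf⟩ := exists_linearIndependent_of_le_finrank hl
  refine ⟨Submodule.span ℂ (Set.range fun i ↦ (f i : E)), ?_, ?_⟩
  · rw [Submodule.span_le]
    rintro _ ⟨i, rfl⟩
    exact (f i).2
  · exact (finrank_span_eq_card (hf.map' W.subtype W.ker_subtype)).trans (Fintype.card_fin l)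

theorem mulVec_eq_zero_of_commute {d : ℕ} {P A B : Matrix (Fin d) (Fin d) ℂ} {a b : ℝ}
    (ha : a ≠ 0) (hcomm : P * ((a : ℂ) • A + (b : ℂ) • B) = ((a : ℂ) • A + (b : ℂ) • B) * P)
    {w : Fin d → ℂ} (hP : P *ᵥ w = 0) (hB : B *ᵥ w = 0) : P *ᵥ (A *ᵥ w) = 0 := by
  have h := congrArg (· *ᵥ w) hcomm
  simp only [← Matrix.mulVec_mulVec, hP, Matrix.mulVec_zero, Matrix.add_mulVec, Matrix.smul_mulVec,
    hB, smul_zero, add_zero, Matrix.mulVec_smul] at h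
  exact (smul_eq_zero.1 h).resolve_left (by exact_mod_cast ha)

theorem mem_smul_corrSet_of_commute {n n₂ n₃ m d : ℕ} (hm : 0 < m) (hd : n₂ + n₃ + m = d)
    (hmn : 0 < n₂ + n₃)
    {P₁ P₂ P₃ : Matrix (Fin d) (Fin d) ℂ} (h₁ : IsProjn P₁) (h₂ : IsProjn P₂) (h₃ : IsProjn P₃)
    (hr₁ : P₁.rank = n) (hr₂ : P₂.rank = n₂) (hr₃ : P₃.rank = n₃)
    {a b c : ℝ} (ha : a ≠ 0) (hb : b ≠ 0)
    (hc₂ : P₂ * ((a : ℂ) • P₁ + (c : ℂ) • P₃) = ((a : ℂ) • P₁ + (c : ℂ) • P₃) * P₂)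
    (hc₃ : P₃ * ((b : ℂ) • P₁ + (c : ℂ) • P₂) = ((b : ℂ) • P₁ + (c : ℂ) • P₂) * P₃) :
    ((1 / (d : ℝ)) * ((P₁ * P₂).trace).re, (1 / (d : ℝ)) * ((P₁ * P₃).trace).re,
        (1 / (d : ℝ)) * ((P₂ * P₃).trace).re) ∈
      (((d : ℝ) - 1) / (d : ℝ)) • corrSet (d - 1) n n₂ n₃ ∪
        (((d : ℝ) - (min n m : ℕ)) / (d : ℝ)) • corrSet (d - min n m) (n - min n m) n₂ n₃ := by
  have hmem {A : Matrix (Fin d) (Fin d) ℂ} {w : EuclideanSpace ℂ (Fin d)} :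
      w ∈ LinearMap.ker A.toEuclideanLin ↔ A *ᵥ w.ofLp = 0 := by
    rw [LinearMap.mem_ker, Matrix.toLpLin_apply, WithLp.toLp_eq_zero]
  by_cases hex : ∃ w : EuclideanSpace ℂ (Fin d), w ≠ 0 ∧ P₁ *ᵥ w.ofLp = 0 ∧ P₂ *ᵥ w.ofLp = 0 ∧
      P₃ *ᵥ w.ofLp = 0
  · left
    obtain ⟨w, hw, hw₁, hw₂, hw₃⟩ := hex
    have hspan {A : Matrix (Fin d) (Fin d) ℂ} (hA : A *ᵥ w.ofLp = 0) :
        ∀ v ∈ Submodule.span ℂ {w}, A *ᵥ v.ofLp = 0 := fun v hv ↦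
      hmem.1 ((Submodule.span_singleton_le_iff_mem _ _).2 (hmem.2 hA) hv)
    have := mem_smul_corrSet_of_subspace (r₁ := n) (ε := 0) h₁ h₂ h₃ (finrank_span_singleton hw)
      (by omega) (by simp [hr₁]) (by simpa using hspan hw₁) (hspan hw₂) (hspan hw₃)
    rwa [hr₂, hr₃, Nat.cast_one] at this
  · right
    have hrange {w : EuclideanSpace ℂ (Fin d)} (hw₂ : P₂ *ᵥ w.ofLp = 0)
        (hw₃ : P₃ *ᵥ w.ofLp = 0) : P₁ *ᵥ w.ofLp = w.ofLp := by
      by_contra hne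
      refine hex ⟨WithLp.toLp 2 (P₁ *ᵥ w.ofLp - w.ofLp), ?_, ?_, ?_, ?_⟩
      · rwa [ne_eq, WithLp.toLp_eq_zero, sub_eq_zero]
      · rw [Matrix.mulVec_sub, Matrix.mulVec_mulVec, h₁.2, sub_self]
      · rw [Matrix.mulVec_sub, mulVec_eq_zero_of_commute ha hc₂ hw₂ hw₃, hw₂, sub_self]
      · rw [Matrix.mulVec_sub, mulVec_eq_zero_of_commute hb hc₃ hw₃ hw₂, hw₃, sub_self]
    have hdim := le_finrank_ker_inf_ker P₂ P₃
    rw [hr₂, hr₃] at hdim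
    obtain ⟨W, hW, hWl⟩ := exists_submodule_le_finrank_eq _
      ((show min n m ≤ d - (n₂ + n₃) by omega).trans hdim)
    have hW₂ : ∀ w ∈ W, P₂ *ᵥ w.ofLp = 0 := fun w hw ↦ hmem.1 (hW hw).1
    have hW₃ : ∀ w ∈ W, P₃ *ᵥ w.ofLp = 0 := fun w hw ↦ hmem.1 (hW hw).2
    have := mem_smul_corrSet_of_subspace (r₁ := n - min n m) (ε := 1) h₁ h₂ h₃ hWl
      (by omega) (by rw [Nat.cast_sub (min_le_left n m), hr₁, one_mul])
      (fun w hw ↦ by rw [hrange (hW₂ w hw) (hW₃ w hw), one_smul]) hW₂ hW₃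
    rwa [hr₂, hr₃] at this

theorem exists_lt_of_notMem_convexHull {K : Set (ℝ × ℝ × ℝ)} (hK : IsCompact K) {x : ℝ × ℝ × ℝ}
    (hx : x ∉ convexHull ℝ K) :
    ∃ a b c : ℝ, a ≠ 0 ∧ b ≠ 0 ∧
      ∀ y ∈ K, a * y.1 + b * y.2.1 + c * y.2.2 < a * x.1 + b * x.2.1 + c * x.2.2 := by
  obtain ⟨f, u, hfK, hfx⟩ := geometric_hahn_banach_closed_point (convex_convexHull ℝ K)
    hK.convexHull_of_finiteDimensional.isClosed hx
  have hf (y : ℝ × ℝ × ℝ) : f y = f (1, 0, 0) * y.1 + f (0, 1, 0) * y.2.1 + f (0, 0, 1) * y.2.2 := by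
    have : y = y.1 • ((1, 0, 0) : ℝ × ℝ × ℝ) + y.2.1 • ((0, 1, 0) : ℝ × ℝ × ℝ) +
        y.2.2 • ((0, 0, 1) : ℝ × ℝ × ℝ) := by
      ext <;> simp
    conv_lhs => rw [this]
    simp only [map_add, map_smul, smul_eq_mul]
    ring
  obtain ⟨B, hB⟩ := (hK.image (f := fun y ↦ y.1 + y.2.1) (by fun_prop)).bddAbove
  set M := max (B - (x.1 + x.2.1)) 1
  have hM : 0 < M := lt_max_of_lt_right one_pos
  obtain ⟨t, ⟨ht0, ht⟩, htne⟩ := ((Set.Ioo_infinite (div_pos (sub_pos.2 hfx) hM)).sdiff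
    (Set.toFinite {-f (1, 0, 0), -f (0, 1, 0)})).nonempty
  simp only [Set.mem_insert_iff, Set.mem_singleton_iff, not_or] at htne
  refine ⟨f (1, 0, 0) + t, f (0, 1, 0) + t, f (0, 0, 1), fun h ↦ htne.1 (by linarith),
    fun h ↦ htne.2 (by linarith), fun y hy ↦ ?_⟩
  have h1 := hfK y (subset_convexHull ℝ K hy)
  have h2 : y.1 + y.2.1 ≤ B := hB ⟨y, hy, rfl⟩
  have h3 : B - (x.1 + x.2.1) ≤ M := le_max_left _ _
  rw [lt_div_iff₀ hM] at ht
  rw [hf] at h1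
  rw [hf x] at ht
  nlinarith [mul_le_mul_of_nonneg_left (show y.1 + y.2.1 - (x.1 + x.2.1) ≤ M by linarith) ht0.le]

/-- Lemma 3.14 (iterated reduction for type III slices): if `k ≤ k'`,
`2n + k + k' = d − m` and `l = min(n, m)`, then `S_d(n, n+k, n+k')` lies in the convex
hull of `((d−1)/d)·S_{d−1}(n, n+k, n+k')` and `((d−l)/d)·S_{d−l}(n−l, n+k, n+k')`. -/
theorem corrSet_typeIII_reduction (k k' n m d : ℕ)
    (hk : 0 < k) (hk' : 0 < k') (hn : 0 < n) (hm : 0 < m) (hd : 0 < d)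
    (hkk : k ≤ k') (hdm : 2 * n + k + k' = d - m) (hmd : m ≤ d) :
    corrSet d n (n + k) (n + k') ⊆
      convexHull ℝ
        ((((d : ℝ) - 1) / (d : ℝ)) • corrSet (d - 1) n (n + k) (n + k') ∪
          (((d : ℝ) - (min n m : ℕ)) / (d : ℝ)) •
            corrSet (d - min n m) (n - min n m) (n + k) (n + k')) := by
  intro x hx
  by_contra hxK
  obtain ⟨a, b, c, ha, hb, hlt⟩ := exists_lt_of_notMem_convexHull
    (((isCompact_corrSet _ _ _ _).smul _).union ((isCompact_corrSet _ _ _ _).smul _)) hxK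
  obtain ⟨z, hz, hmax⟩ := (isCompact_corrSet d n (n + k) (n + k')).exists_isMaxOn ⟨x, hx⟩
    (f := fun y ↦ a * y.1 + b * y.2.1 + c * y.2.2) (by fun_prop)
  refine (hlt z ?_).not_ge (hmax hx)
  obtain ⟨P₁, P₂, P₃, h₁, h₂, h₃, hr₁, hr₂, hr₃, rfl⟩ := hz
  have hdinv : 0 < 1 / (d : ℝ) := by positivity
  have hherm {s t : ℝ} {A B : Matrix (Fin d) (Fin d) ℂ} (hA : IsProjn A) (hB : IsProjn B) :
      ((s : ℂ) • A + (t : ℂ) • B).IsHermitian := by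
    rw [Matrix.IsHermitian, Matrix.conjTranspose_add, Matrix.conjTranspose_smul,
      Matrix.conjTranspose_smul, hA.1.eq, hB.1.eq]
    simp
  have htrace (s t : ℝ) (Q A B : Matrix (Fin d) (Fin d) ℂ) :
      (Q * ((s : ℂ) • A + (t : ℂ) • B)).trace.re =
        s * (Q * A).trace.re + t * (Q * B).trace.re := by
    simp [Matrix.mul_add]
  refine mem_smul_corrSet_of_commute (c := c) hm (by omega) (by omega) h₁ h₂ h₃ hr₁ hr₂ hr₃ ha hb
    (mul_comm_of_forall_unitary_trace_le h₂.1 (hherm h₁ h₃) fun U hU ↦ ?_)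
    (mul_comm_of_forall_unitary_trace_le h₃.1 (hherm h₁ h₂) fun U hU ↦ ?_)
  · obtain ⟨hQ, hQr⟩ := h₂.conj_unitary hU
    have h := hmax ⟨P₁, U * P₂ * Uᴴ, P₃, h₁, hQ, h₃, hr₁, hQr.trans hr₂, hr₃, rfl⟩
    simp only [Set.mem_ofPred_eq] at h
    rw [htrace, htrace, Matrix.trace_mul_comm _ P₁, Matrix.trace_mul_comm _ P₁]
    refine le_of_mul_le_mul_left ?_ hdinv
    linarith
  · obtain ⟨hQ, hQr⟩ := h₃.conj_unitary hU
    have h := hmax ⟨P₁, P₂, U * P₃ * Uᴴ, h₁, h₂, hQ, hr₁, hr₂, hQr.trans hr₃, rfl⟩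
    simp only [Set.mem_ofPred_eq] at h
    rw [htrace, htrace, Matrix.trace_mul_comm _ P₁, Matrix.trace_mul_comm _ P₁,
      Matrix.trace_mul_comm _ P₂, Matrix.trace_mul_comm _ P₂]
    refine le_of_mul_le_mul_left ?_ hdinv
    linarith
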